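/- There exists C > 0 such that for every measurable f : ℝ → ℂ with N₁(f) < ∞, one has sup_{ξ > 1} ∫_{{ξ₁ : ξ₁ > ξ}} |(ξ − ξ₁)/ξ₁| · |ξ₁ f(ξ₁)| · |(ξ − ξ₁) f(ξ − ξ₁)| dξ₁ ≤ C N₁(f)². In particular, on the region ξ₁ > ξ > 1 the multiplier (ξ−ξ₁)/ξ₁ is bounded, and the Fourier transform of the quadratic nonlinearity Q₊(V) of the gauged Benjamin–Ono equation is uniformly bounded by C‖V‖²_{H¹} when f is the Fourier transform of V. -/

import Mathlib

open MeasureTheory Real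
open scoped ENNReal

/-- Japanese bracket `⟨ξ⟩ = (1+ξ²)^{1/2}`. -/
noncomputable def jap (ξ : ℝ) : ℝ := Real.sqrt (1 + ξ ^ 2)

/-- Frequency-side Sobolev norm `N_σ(f) = (∫ ⟨ξ⟩^{2σ} |f(ξ)|² dξ)^{1/2}`,
valued in `ℝ≥0∞`. -/
noncomputable def sobNorm (σ : ℝ) (f : ℝ → ℂ) : ℝ≥0∞ :=
  (∫⁻ ξ : ℝ, ENNReal.ofReal (jap ξ ^ (2 * σ)) * (‖f ξ‖₊ : ℝ≥0∞) ^ 2) ^ (1 / 2 : ℝ)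

/-- The squared `H¹` norm on the frequency side. -/
theorem sobNorm_one_sq (f : ℝ → ℂ) :
    sobNorm 1 f ^ 2 = ∫⁻ ξ : ℝ, ENNReal.ofReal ((1 + ξ ^ 2) * ‖f ξ‖ ^ 2) := by
  unfold sobNorm
  rw [← ENNReal.rpow_natCast, ← ENNReal.rpow_mul]
  norm_num
  refine lintegral_congr fun ξ => ?_
  rw [jap, Real.sq_sqrt (by positivity), ENNReal.ofReal_mul (by positivity),
    ENNReal.ofReal_pow (norm_nonneg _), ofReal_norm, enorm_eq_nnnorm]

/-- On the region `ξ₁ > ξ > 0` the multiplier `(ξ - ξ₁) / ξ₁` is bounded by one. -/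
theorem abs_sub_div_le_one {ξ η : ℝ} (hξ : 0 < ξ) (h : ξ < η) : |(ξ - η) / η| ≤ 1 := by
  have hη : 0 < η := hξ.trans h
  rw [abs_div, abs_of_neg (sub_neg.mpr h), abs_of_pos hη, div_le_one hη]
  linarith

/-- If `|m| ≤ 1`, then `|m| (|a| u) (|b| v)` is bounded by the sum of the two `H¹` densities. -/
theorem multiplier_mul_le {m a b u v : ℝ} (hm : |m| ≤ 1) (hu : 0 ≤ u) (hv : 0 ≤ v) :
    |m| * (|a| * u) * (|b| * v) ≤ (1 + a ^ 2) * u ^ 2 + (1 + b ^ 2) * v ^ 2 := by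
  have hau : 0 ≤ |a| * u := by positivity
  have hbv : 0 ≤ |b| * v := by positivity
  calc |m| * (|a| * u) * (|b| * v) ≤ 1 * (|a| * u) * (|b| * v) := by gcongr
    _ ≤ (|a| * u) ^ 2 + (|b| * v) ^ 2 := by nlinarith [sq_nonneg (|a| * u - |b| * v)]
    _ = a ^ 2 * u ^ 2 + b ^ 2 * v ^ 2 := by rw [mul_pow, mul_pow, sq_abs, sq_abs]
    _ ≤ (1 + a ^ 2) * u ^ 2 + (1 + b ^ 2) * v ^ 2 := by gcongr <;> linarith

/-- The Fourier transform of the quadratic nonlinearity `Q₊(V)` of the gauged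
Benjamin–Ono equation is uniformly bounded by `C‖V‖²_{H¹}`: on the region
`ξ₁ > ξ > 1` the multiplier `(ξ-ξ₁)/ξ₁` is bounded. -/
theorem quadratic_nonlinearity_fourier_bounded :
    ∃ C : ℝ, 0 < C ∧ ∀ f : ℝ → ℂ, Measurable f → sobNorm 1 f < ⊤ →
      ∀ ξ : ℝ, 1 < ξ →
        (∫⁻ ξ₁ : ℝ,
          ENNReal.ofReal (if ξ < ξ₁ then
            |(ξ - ξ₁) / ξ₁| * (|ξ₁| * ‖f ξ₁‖) * (|ξ - ξ₁| * ‖f (ξ - ξ₁)‖)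
          else 0))
        ≤ ENNReal.ofReal C * sobNorm 1 f ^ 2 := by
  refine ⟨2, two_pos, fun f hf _ ξ hξ => ?_⟩
  rw [sobNorm_one_sq]
  set g : ℝ → ℝ≥0∞ := fun η => ENNReal.ofReal ((1 + η ^ 2) * ‖f η‖ ^ 2) with hg
  have hgm : Measurable g := by fun_prop
  calc _ ≤ ∫⁻ η : ℝ, (g η + g (ξ - η)) := by
        refine lintegral_mono fun η => ?_
        rw [hg, ← ENNReal.ofReal_add (by positivity) (by positivity)]
        refine ENNReal.ofReal_le_ofReal ?_
        split_ifs with h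
        · exact multiplier_mul_le (abs_sub_div_le_one (by linarith) h) (norm_nonneg _)
            (norm_nonneg _)
        · positivity
    _ = (∫⁻ η : ℝ, g η) + ∫⁻ η : ℝ, g η := by
        rw [lintegral_add_left hgm, lintegral_sub_left_eq_self g ξ]
    _ = ENNReal.ofReal 2 * ∫⁻ η : ℝ, g η := by
        rw [ENNReal.ofReal_ofNat, two_mul]
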